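/- Let n ≥ 1 and let e₁, …, eₙ be integers such that det T(e₁,…,eₙ) ∈ {−1, 0, 1}. Then there is a sequence (f₁,…,fₙ) obtained from (e₁,…,eₙ) by possibly reversing the order and/or replacing every term by its negative (i.e. (f₁,…,fₙ) is one of (e₁,…,eₙ), (eₙ,…,e₁), (−e₁,…,−eₙ), (−eₙ,…,−e₁)) such that one of the following holds: (i) f₁ = 0; (ii) n = 1 and f₁ = 1; (iii) n ≥ 2, f₁ = 1 and f₂ ∈ {0, 1, 2, 3}; (iv) there is an index i with 1 < i < n such that fᵢ = 0 and f_{i−1}·f_{i+1} ≤ 0; (v) there is an index i with 1 < i < n such that fᵢ = 1, f_{i−1} ∈ {0, 1, 2, 3} and f_{i+1} ≥ 0. -/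

import Mathlib

/-- `plumbT e` is the intersection matrix of the linear plumbing of spheres with
Euler numbers `e 0, …, e (n-1)`: diagonal entries `e i`, entries `1` on the
sub- and super-diagonal, and `0` elsewhere. -/
def plumbT {n : ℕ} (e : Fin n → ℤ) : Matrix (Fin n) (Fin n) ℤ :=
  Matrix.of fun i j =>
    if i = j then e i
    else if (i : ℕ) + 1 = (j : ℕ) ∨ (j : ℕ) + 1 = (i : ℕ) then 1 else 0

/-- Laplace expansion of the determinant of a linear plumbing along its first sphere. -/
theorem det_plumbT_succ_succ {n : ℕ} (e : Fin (n + 2) → ℤ) :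
    (plumbT e).det =
      e 0 * (plumbT fun i => e i.succ).det - (plumbT fun i => e i.succ.succ).det := by
  have hsub : ((plumbT e).submatrix Fin.succ Fin.succ) = plumbT fun i => e i.succ := by
    ext i j
    simp [plumbT, Fin.succ_inj]
  have hminor : ((plumbT e).submatrix Fin.succ (Fin.succAbove 1)).det =
      (plumbT fun i => e i.succ.succ).det := by
    rw [Matrix.det_succ_column_zero, Fin.sum_univ_succ, Finset.sum_eq_zero]
    · have h : ((plumbT e).submatrix Fin.succ (Fin.succAbove 1)).submatrix
          (Fin.succAbove 0) Fin.succ = plumbT fun i => e i.succ.succ := by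
        ext i j
        have hj : Fin.succAbove (1 : Fin (n + 2)) j.succ = j.succ.succ := by
          rw [← Fin.succ_zero_eq_one, Fin.succ_succAbove_succ, Fin.succAbove_zero]
        simp [plumbT, Fin.succ_inj, hj]
      rw [h]
      simp [plumbT]
    · intro i _
      have : (plumbT e) i.succ.succ 0 = 0 := by
        simp [plumbT, Fin.ext_iff]
      simp [this]
  rw [Matrix.det_succ_row_zero, Fin.sum_univ_succ, Fin.sum_univ_succ, Finset.sum_eq_zero]
  · have h1 : (Fin.succ 0 : Fin (n + 2)) = 1 := rfl
    have h00 : plumbT e 0 0 = e 0 := by simp [plumbT]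
    have h01 : plumbT e 0 1 = 1 := by simp [plumbT]
    rw [h1, hminor, h00, h01, Fin.succAbove_zero, hsub]
    simp
    ring
  · intro i _
    have : (plumbT e) 0 i.succ.succ = 0 := by
      simp [plumbT, Fin.ext_iff]
    simp [this]

/-- The determinant of the linear plumbing with Euler numbers `g (k - 1), …, g 0`. -/
def plumbDet (g : ℕ → ℤ) (k : ℕ) : ℤ :=
  (plumbT fun i : Fin k => g (k - 1 - i)).det

theorem plumbDet_zero (g : ℕ → ℤ) : plumbDet g 0 = 1 := by
  simp [plumbDet]

theorem plumbDet_one (g : ℕ → ℤ) : plumbDet g 1 = g 0 := by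
  simp [plumbDet, plumbT]

theorem plumbDet_add_two (g : ℕ → ℤ) (k : ℕ) :
    plumbDet g (k + 2) = g (k + 1) * plumbDet g (k + 1) - plumbDet g k := by
  have h1 (i : Fin (k + 1)) : k + 2 - 1 - (i.succ : ℕ) = k + 1 - 1 - i := by
    simp only [Fin.val_succ]; omega
  have h2 (i : Fin k) : k + 1 - 1 - (i.succ : ℕ) = k - 1 - i := by
    simp only [Fin.val_succ]; omega
  simp only [plumbDet, det_plumbT_succ_succ, h1, h2]
  rfl

/-- Three consecutive Euler numbers to which, up to sign and reversal, neither of the two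
interior simplifications applies. -/
def IsReducedTriple (p c d : ℤ) : Prop :=
  (c = 0 → 0 < p * d) ∧
  (c = 1 → ¬ (0 ≤ p ∧ p ≤ 3 ∧ 0 ≤ d) ∧ ¬ (0 ≤ d ∧ d ≤ 3 ∧ 0 ≤ p)) ∧
  (c = -1 → ¬ (p ≤ 0 ∧ -3 ≤ p ∧ d ≤ 0) ∧ ¬ (d ≤ 0 ∧ -3 ≤ d ∧ p ≤ 0))

theorem IsReducedTriple.neg {p c d : ℤ} (h : IsReducedTriple p c d) : IsReducedTriple (-p) (-c) (-d) := by
  obtain ⟨h0, h1, h2⟩ := h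
  refine ⟨fun hc => ?_, fun hc => ?_, fun hc => ?_⟩
  · have := h0 (by omega)
    linarith [neg_mul_neg p d]
  · have := h2 (by omega)
    omega
  · have := h1 (by omega)
    omega

/-- Bounds on the ratio `r` of consecutive determinants at a sphere of Euler number `c ≥ 0`
preceded by one of Euler number `p`. -/
def PosBound (p c : ℤ) (r : ℚ) : Prop :=
  (4 ≤ c ∧ 2 < r) ∨ (2 ≤ c ∧ c ≤ 3 ∧ 1 < r) ∨ (c = 1 ∧ 4 ≤ p ∧ 1 / 2 < r) ∨
  (c = 1 ∧ 0 ≤ p ∧ p ≤ 3 ∧ 0 < r) ∨ (c = 1 ∧ p < 0 ∧ 1 < r) ∨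
  (c = 0 ∧ 0 < p ∧ -1 < r ∧ r < 0)

/-- `PosBound` up to a simultaneous change of signs. -/
def RatioBound (p c : ℤ) (r : ℚ) : Prop :=
  PosBound p c r ∨ PosBound (-p) (-c) (-r)

theorem RatioBound.ne_zero {p c : ℤ} {r : ℚ} (h : RatioBound p c r) : r ≠ 0 := by
  rintro rfl
  rcases h with h | h <;> norm_num [PosBound] at h

theorem PosBound.step {p c d : ℤ} {r : ℚ} (h : PosBound p c r) (hr : IsReducedTriple p c d) :
    RatioBound c d (d - r⁻¹) := by
  obtain ⟨h0, h1, -⟩ := hr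
  by_cases hc : c = 0
  · have hp : 0 < p ∧ -1 < r ∧ r < 0 := by
      unfold PosBound at h
      rcases h with h | h | h | h | h | h
      · omega
      · omega
      · omega
      · omega
      · omega
      · exact h.2
    have hd : 0 < d := pos_of_mul_pos_right (h0 hc) hp.1.le
    have hinv : r⁻¹ < -1 := by
      have := one_lt_inv₀ (a := -r) (by linarith)
      rw [inv_neg] at this
      linarith [this.2 (by linarith)]
    have hdq : (1 : ℚ) ≤ d := by exact_mod_cast hd
    left
    rcases lt_or_ge d 2 with h2 | h2
    · exact Or.inr (Or.inr (Or.inr (Or.inl ⟨by omega, by omega, by omega, by linarith⟩)))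
    · rcases lt_or_ge d 4 with h4 | h4
      · exact Or.inr (Or.inl ⟨h2, by omega, by linarith⟩)
      · exact Or.inl ⟨h4, by linarith⟩
  · have hcpos : 0 < c := by
      unfold PosBound at h
      omega
    have hrpos : 0 < r := by
      unfold PosBound at h
      rcases h with h | h | h | h | h | h
      · linarith [h.2]
      · linarith [h.2.2]
      · linarith [h.2.2]
      · linarith [h.2.2.2]
      · linarith [h.2.2]
      · omega
    have hinvpos : 0 < r⁻¹ := inv_pos.2 hrpos
    have hinv1 (h : 1 < r) : r⁻¹ < 1 := inv_lt_one_of_one_lt₀ h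
    rcases lt_or_ge d 0 with hd | hd
    · right
      have hdq : (d : ℚ) ≤ -1 := by exact_mod_cast (by omega : d ≤ -1)
      rcases lt_or_ge (-d) 2 with h2 | h2
      · exact Or.inr (Or.inr (Or.inr (Or.inr (Or.inl ⟨by omega, by omega, by linarith⟩))))
      · have h2q : (2 : ℚ) ≤ -d := by exact_mod_cast h2
        rcases lt_or_ge (-d) 4 with h4 | h4
        · exact Or.inr (Or.inl ⟨h2, by omega, by linarith⟩)
        · exact Or.inl ⟨h4, by linarith⟩
    · left
      rcases le_or_gt d 3 with hd3 | hd3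
      · have hr1 : 1 < r := by
          unfold PosBound at h
          rcases h with h | h | h | h | h | h
          · linarith [h.2]
          · exact h.2.2
          · have := h1 h.1
            omega
          · have := h1 h.1
            omega
          · exact h.2.2
          · omega
        have hlt := hinv1 hr1
        have hd4 : d = 0 ∨ d = 1 ∨ 2 ≤ d := by omega
        rcases hd4 with rfl | rfl | h2
        · exact Or.inr (Or.inr (Or.inr (Or.inr (Or.inr
            ⟨rfl, hcpos, by push_cast; linarith, by push_cast; linarith⟩))))
        · rcases lt_or_ge c 4 with h4 | h4
          · exact Or.inr (Or.inr (Or.inr (Or.inl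
              ⟨rfl, hcpos.le, by omega, by push_cast; linarith⟩)))
          · have hr2 : 2 < r := by
              unfold PosBound at h
              rcases h with h | h | h | h | h | h
              · exact h.2
              all_goals omega
            have : r⁻¹ < 1 / 2 := by
              rw [one_div]
              exact inv_strictAnti₀ (by norm_num) hr2
            exact Or.inr (Or.inr (Or.inl ⟨rfl, h4, by push_cast; linarith⟩))
        · have h2q : (2 : ℚ) ≤ d := by exact_mod_cast h2
          exact Or.inr (Or.inl ⟨h2, hd3, by linarith⟩)
      · have hr2 : 1 / 2 < r := by
          unfold PosBound at h
          rcases h with h | h | h | h | h | h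
          · linarith [h.2]
          · linarith [h.2.2]
          · exact h.2.2
          · have := h1 h.1
            omega
          · linarith [h.2.2]
          · omega
        have : r⁻¹ < 2 := by
          have := inv_strictAnti₀ (by norm_num) hr2
          norm_num at this ⊢
          exact this
        have h4q : (4 : ℚ) ≤ d := by exact_mod_cast hd3
        exact Or.inl ⟨hd3, by linarith⟩

theorem RatioBound.step {p c d : ℤ} {r : ℚ} (h : RatioBound p c r) (hr : IsReducedTriple p c d) :
    RatioBound c d (d - r⁻¹) := by
  rcases h with h | h
  · exact h.step hr
  · have := h.step hr.neg
    have heq : ((-d : ℤ) : ℚ) - (-r)⁻¹ = -(d - r⁻¹) := by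
      rw [inv_neg]
      push_cast
      ring
    rw [heq] at this
    rcases this with h | h
    · exact Or.inr h
    · exact Or.inl (by simpa only [neg_neg] using h)

theorem RatioBound.two_lt_abs {p c : ℤ} {r : ℚ} (h : RatioBound p c r) (hc : 4 ≤ |c|) :
    2 < |r| := by
  unfold RatioBound PosBound at h
  rcases h with h | h
  · have : 2 < r := by
      rcases h with h | h | h | h | h | h
      · exact h.2
      all_goals (exfalso; rcases abs_cases c with hc | hc <;> omega)
    exact lt_abs.2 (Or.inl this)
  · have : 2 < -r := by
      rcases h with h | h | h | h | h | h
      · exact h.2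
      all_goals (exfalso; rcases abs_cases c with hc | hc <;> omega)
    exact lt_abs.2 (Or.inr this)

theorem RatioBound.one_lt_abs {p c : ℤ} {r : ℚ} (h : RatioBound p c r) (hc : c ≠ 0)
    (hpos : c = 1 → p < 0) (hneg : c = -1 → 0 < p) : 1 < |r| := by
  unfold RatioBound PosBound at h
  rcases h with h | h
  · have : 1 < r := by
      rcases h with h | h | h | h | h | h
      · linarith [h.2]
      · exact h.2.2
      · omega
      · omega
      · exact h.2.2
      · omega
    exact lt_abs.2 (Or.inl this)
  · have : 1 < -r := by
      rcases h with h | h | h | h | h | h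
      · linarith [h.2]
      · exact h.2.2
      · omega
      · omega
      · exact h.2.2
      · omega
    exact lt_abs.2 (Or.inr this)

/-- The Euler number preceding `g k`, where a large one with the sign of `g 0` is put in
front of `g 0`. -/
def prevEuler (g : ℕ → ℤ) : ℕ → ℤ
  | 0 => if 0 < g 0 then 4 else -4
  | k + 1 => g k

theorem plumbDet_ratioBound (g : ℕ → ℤ) (n : ℕ) (h0 : g 0 ≠ 0)
    (hred : ∀ k, k + 1 < n → IsReducedTriple (prevEuler g k) (g k) (g (k + 1)))
    (k : ℕ) (hk : k < n) :
    plumbDet g k ≠ 0 ∧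
      RatioBound (prevEuler g k) (g k) ((plumbDet g (k + 1) : ℚ) / plumbDet g k) := by
  induction k with
  | zero =>
    refine ⟨by simp [plumbDet_zero], ?_⟩
    simp only [zero_add, plumbDet_zero, plumbDet_one, prevEuler, Int.cast_one, div_one]
    have aux (c : ℤ) (hc : 0 < c) : PosBound 4 c c := by
      rcases lt_or_ge c 2 with h2 | h2
      · obtain rfl : c = 1 := by omega
        norm_num [PosBound]
      · have h2q : (2 : ℚ) ≤ c := by exact_mod_cast h2
        rcases lt_or_ge c 4 with h4 | h4
        · exact Or.inr (Or.inl ⟨h2, by omega, by linarith⟩)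
        · have h4q : (4 : ℚ) ≤ c := by exact_mod_cast h4
          exact Or.inl ⟨h4, by linarith⟩
    split_ifs with h
    · exact Or.inl (aux _ h)
    · refine Or.inr ?_
      have := aux (-g 0) (by omega)
      push_cast at this
      simpa using this
  | succ k ih =>
    obtain ⟨hk0, hb⟩ := ih (by omega)
    have hk1 : plumbDet g (k + 1) ≠ 0 := by
      intro h
      exact hb.ne_zero (by simp [h])
    refine ⟨hk1, ?_⟩
    have hk1q : (plumbDet g (k + 1) : ℚ) ≠ 0 := by exact_mod_cast hk1
    have heq : (plumbDet g (k + 2) : ℚ) / plumbDet g (k + 1) =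
        g (k + 1) - ((plumbDet g (k + 1) : ℚ) / plumbDet g k)⁻¹ := by
      rw [plumbDet_add_two, inv_div]
      push_cast
      field_simp
    rw [heq]
    exact hb.step (hred k hk)

/-- A line of spheres to which no simplification applies has determinant of absolute value
at least two. -/
theorem one_lt_abs_plumbDet (g : ℕ → ℤ) (n : ℕ) (h0 : g 0 ≠ 0) (hlast : g n ≠ 0)
    (hred : ∀ k, k < n → IsReducedTriple (prevEuler g k) (g k) (g (k + 1)))
    (hone : n = 0 → 1 < |g 0|)
    (hend : ∀ k, n = k + 1 → (g n = 1 → ¬ (0 ≤ g k ∧ g k ≤ 3)) ∧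
      (g n = -1 → ¬ (g k ≤ 0 ∧ -3 ≤ g k))) :
    1 < |plumbDet g (n + 1)| := by
  have main := plumbDet_ratioBound g (n + 1) h0 (fun k hk => hred k (by omega))
  obtain _ | m := n
  · simpa [plumbDet_one] using hone rfl
  obtain ⟨hb0, hb⟩ := main (m + 1) (by omega)
  obtain ⟨hend1, hend2⟩ := hend m rfl
  by_cases hspecial : (g (m + 1) = 1 ∧ 0 ≤ g m) ∨ (g (m + 1) = -1 ∧ g m ≤ 0)
  · obtain ⟨ha0, ha⟩ := main m (by omega)
    have h4 : 4 ≤ |g m| := by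
      rcases abs_cases (g m) with h | h <;> omega
    have h2 := ha.two_lt_abs h4
    have hpos : (0 : ℚ) < |(plumbDet g m : ℚ)| := abs_pos.2 (by exact_mod_cast ha0)
    rw [abs_div, lt_div_iff₀ hpos] at h2
    have h2z : 2 * |plumbDet g m| < |plumbDet g (m + 1)| := by exact_mod_cast h2
    have hposz : 0 < |plumbDet g m| := abs_pos.2 ha0
    rw [plumbDet_add_two]
    rcases hspecial with h | h <;> rw [h.1] <;> grind
  · have h1 := hb.one_lt_abs hlast (by simp only [prevEuler]; omega)
      (by simp only [prevEuler]; omega)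
    have hpos : (0 : ℚ) < |(plumbDet g (m + 1) : ℚ)| := abs_pos.2 (by exact_mod_cast hb0)
    rw [abs_div, lt_div_iff₀ hpos, one_mul] at h1
    have h1z : |plumbDet g (m + 1)| < |plumbDet g (m + 1 + 1)| := by exact_mod_cast h1
    have hposz : 0 < |plumbDet g (m + 1)| := abs_pos.2 hb0
    omega

/-- The paper's lemma on plumbing lines whose boundary is `S³` or `S²×S¹`
(rephrased via `det T(e₁,…,eₙ) ∈ {−1,0,1}`): up to reversing the sequence
and/or changing all signs, one of five simplifying configurations occurs.
Indices are `0`-based, so `f₁ = f ⟨0,_⟩` and interior indices are `j+1` with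
`j + 3 ≤ n`. -/
theorem plumbing_line_lemma (n : ℕ) (hn : 1 ≤ n) (e : Fin n → ℤ)
    (hdet : (plumbT e).det = -1 ∨ (plumbT e).det = 0 ∨ (plumbT e).det = 1) :
    ∃ f : Fin n → ℤ,
      ((∀ i, f i = e i) ∨ (∀ i, f i = e i.rev) ∨
        (∀ i, f i = -e i) ∨ (∀ i, f i = -e i.rev)) ∧
      (f ⟨0, hn⟩ = 0 ∨
       (n = 1 ∧ f ⟨0, hn⟩ = 1) ∨
       (∃ h2 : 2 ≤ n, f ⟨0, hn⟩ = 1 ∧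
         (f ⟨1, h2⟩ = 0 ∨ f ⟨1, h2⟩ = 1 ∨ f ⟨1, h2⟩ = 2 ∨ f ⟨1, h2⟩ = 3)) ∨
       (∃ j : ℕ, ∃ h : j + 3 ≤ n,
         f ⟨j + 1, by omega⟩ = 0 ∧
         f ⟨j, by omega⟩ * f ⟨j + 2, by omega⟩ ≤ 0) ∨
       (∃ j : ℕ, ∃ h : j + 3 ≤ n,
         f ⟨j + 1, by omega⟩ = 1 ∧
         (f ⟨j, by omega⟩ = 0 ∨ f ⟨j, by omega⟩ = 1 ∨
           f ⟨j, by omega⟩ = 2 ∨ f ⟨j, by omega⟩ = 3) ∧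
         0 ≤ f ⟨j + 2, by omega⟩)) := by
  by_contra hcon
  obtain ⟨m, rfl⟩ : ∃ m, n = m + 1 := ⟨n - 1, by omega⟩
  have hE : ¬ _ := fun h => hcon ⟨e, Or.inl fun _ => rfl, h⟩
  have hR : ¬ _ := fun h => hcon ⟨fun i => e i.rev, Or.inr (Or.inl fun _ => rfl), h⟩
  have hN : ¬ _ := fun h => hcon ⟨fun i => -e i, Or.inr (Or.inr (Or.inl fun _ => rfl)), h⟩
  have hS : ¬ _ := fun h => hcon ⟨fun i => -e i.rev, Or.inr (Or.inr (Or.inr fun _ => rfl)), h⟩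
  let g : ℕ → ℤ := fun k => if h : k < m + 1 then e ⟨m - k, by omega⟩ else 0
  have hg (k : ℕ) (h : k < m + 1) : e (Fin.rev ⟨k, h⟩) = g k := by
    simp only [g, dif_pos h]
    congr 1
    ext
    simp [Fin.val_rev]
  have hg2 (k : ℕ) (h : k < m + 1) : e ⟨k, h⟩ = g (m - k) := by
    rw [← hg (m - k) (by omega)]
    congr 1
    ext
    simp only [Fin.val_rev]
    omega
  have hdetg : (plumbT e).det = plumbDet g (m + 1) := by
    unfold plumbDet
    congr 2
    funext i
    exact hg2 i i.2
  simp only [not_or, not_exists, not_and, hg, hg2] at hE hR hN hS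
  obtain ⟨hE0, hE1, hE2, -, hE4⟩ := hE
  obtain ⟨hR0, -, hR2, hR3, hR4⟩ := hR
  obtain ⟨-, hN1, hN2, -, hN4⟩ := hN
  obtain ⟨-, -, hS2, -, hS4⟩ := hS
  simp only [Nat.sub_zero] at hE0 hE1 hE2 hN1 hN2
  have hred (k : ℕ) (hk : k < m) :
      IsReducedTriple (prevEuler g k) (g k) (g (k + 1)) := by
    obtain _ | k := k
    · have := hR2 (by omega)
      have := hS2 (by omega)
      simp only [prevEuler, zero_add]
      exact ⟨fun h => absurd h hR0, fun h => by split_ifs <;> omega,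
        fun h => by split_ifs <;> omega⟩
    · have := hR4 k (by omega)
      have := hS4 k (by omega)
      have hE4 := hE4 (m - k - 2) (by omega)
      have hN4 := hN4 (m - k - 2) (by omega)
      rw [show m - (m - k - 2 + 1) = k + 1 by omega, show m - (m - k - 2) = k + 2 by omega,
        show m - (m - k - 2 + 2) = k by omega] at hE4 hN4
      simp only [prevEuler, add_assoc, Nat.reduceAdd]
      exact ⟨fun h => not_le.1 (hR3 k (by omega) h), fun h => by omega, fun h => by omega⟩
  have habs := one_lt_abs_plumbDet g m hR0 hE0 hred
    (fun h => by subst h; rcases abs_cases (g 0) with h | h <;> omega)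
    (fun k h => by
      subst h
      have := hE2 (by omega)
      have := hN2 (by omega)
      simp only [Nat.add_sub_cancel] at *
      omega)
  rw [← hdetg] at habs
  rcases hdet with h | h | h <;> simp [h] at habs
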